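/- Let n ≥ 1. For Lebesgue-almost every z ∈ ℂⁿ (identifying ℂⁿ with ℝ^{2n}), ω(z) = (n−1)/2. -/

import Mathlib

open MeasureTheory

noncomputable def omegaStd (n : ℕ) (z : Fin n → ℂ) : ENNReal :=
  sSup (ENNReal.ofReal '' {v : ℝ | 0 < v ∧
    {pq : (Fin n → ℤ) × ℤ |
      ‖(∑ i, z i * (pq.1 i : ℂ)) + (pq.2 : ℂ)‖ ≤ ‖pq.1‖ ^ (-v)}.Infinite})

lemma aux_summable (n : ℕ) (s : ℝ) (hs : (n : ℝ) < s) :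
    Summable fun q : Fin n → ℤ => ‖q‖ ^ (-s) := by
  let b := Pi.basisFun ℝ (Fin n)
  let L := Submodule.span ℤ (Set.range b)
  have hr : Module.finrank ℤ L = n := by
    rw [ZLattice.rank ℝ L]; simp
  have h := ZLattice.summable_norm_rpow L (-s) (by rw [hr]; linarith)
  let f : (Fin n → ℤ) → L := fun q => ⟨fun i => (q i : ℝ), by
    have : (fun i => (q i : ℝ)) = ∑ i, q i • b i := by
      ext j
      simp [b, Pi.single_apply]
    rw [this]
    exact Submodule.sum_mem _ fun i _ => Submodule.smul_mem _ _ (Submodule.subset_span ⟨i, rfl⟩)⟩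
  have hf : Function.Injective f := by
    intro x y hxy
    have := congrArg Subtype.val hxy
    ext i
    have := congrFun this i
    simpa [f] using this
  have h2 := h.comp_injective hf
  refine h2.congr fun q => ?_
  have : ‖f q‖ = ‖q‖ := by
    change ‖(fun i => (q i : ℝ))‖ = ‖q‖
    have : ∀ b, ‖((q b : ℤ) : ℝ)‖₊ = ‖q b‖₊ := fun b => by
      ext; simp [Int.norm_eq_abs]
    simp [Pi.norm_def, this]
  simp only [Function.comp, this]

lemma aux_norm_ge_one {n : ℕ} {q : Fin n → ℤ} (hq : q ≠ 0) : 1 ≤ ‖q‖ := by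
  obtain ⟨i, hi⟩ := Function.ne_iff.1 hq
  refine le_trans ?_ (norm_le_pi_norm q i)
  rw [Int.norm_eq_abs]
  exact_mod_cast Int.one_le_abs hi

lemma aux_measure (m : ℕ) (R : ℝ) (q : Fin (m+1) → ℤ) (hq : q ≠ 0) (p : ℤ) (δ : ℝ) (hδ : 0 ≤ δ) :
    volume {z : Fin (m+1) → ℂ | ‖z‖ ≤ R ∧ ‖(∑ i, z i * (q i : ℂ)) + (p : ℂ)‖ ≤ δ} ≤
      ENNReal.ofReal ((δ / ‖q‖)^2) * ((NNReal.pi : ENNReal) *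
        volume (Metric.closedBall (0 : Fin m → ℂ) R)) := by
  obtain ⟨i, hi⟩ : ∃ i, ‖q‖ = ‖q i‖ := by
    obtain ⟨i, -, hi⟩ := Finset.exists_mem_eq_sup' (Finset.univ_nonempty) (fun i => ‖q i‖₊)
    refine ⟨i, ?_⟩
    rw [Pi.norm_def, ← Finset.sup'_eq_sup Finset.univ_nonempty, hi]; rfl
  have hpos : 0 < ‖q‖ := lt_of_lt_of_le one_pos (aux_norm_ge_one hq)
  have hqi : (q i : ℂ) ≠ 0 := by
    rw [hi] at hpos
    exact_mod_cast norm_pos_iff.1 hpos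
  have hqn : ‖(q i : ℂ)‖ = ‖q‖ := by rw [hi]; simp [Int.norm_eq_abs]
  let T : Set (ℂ × (Fin m → ℂ)) := {w | ‖w.2‖ ≤ R ∧
    ‖w.1 * (q i : ℂ) + ((∑ j, w.2 j * (q (i.succAbove j) : ℂ)) + (p : ℂ))‖ ≤ δ}
  have hT : MeasurableSet T := by
    apply IsClosed.measurableSet
    have c1 : IsClosed {w : ℂ × (Fin m → ℂ) | ‖w.2‖ ≤ R} :=
      isClosed_le (by fun_prop) (by fun_prop)
    have c2 : IsClosed {w : ℂ × (Fin m → ℂ) | ‖w.1 * (q i : ℂ) +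
        ((∑ j, w.2 j * (q (i.succAbove j) : ℂ)) + (p : ℂ))‖ ≤ δ} :=
      isClosed_le (by fun_prop) (by fun_prop)
    exact c1.inter c2
  have hmp := volume_preserving_piFinSuccAbove (fun _ : Fin (m+1) => ℂ) i
  calc _ ≤ volume ((MeasurableEquiv.piFinSuccAbove (fun _ : Fin (m+1) => ℂ) i) ⁻¹' T) := by
        apply measure_mono
        rintro z ⟨hz, hz2⟩
        have hR : 0 ≤ R := (norm_nonneg z).trans hz
        refine ⟨?_, ?_⟩
        · refine (pi_norm_le_iff_of_nonneg hR).2 fun j => ?_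
          exact (norm_le_pi_norm z (i.succAbove j)).trans hz
        · rw [Fin.sum_univ_succAbove _ i, add_assoc] at hz2
          exact hz2
    _ = volume T := hmp.measure_preimage hT.nullMeasurableSet
    _ = ∫⁻ y, volume ((fun x => (x, y)) ⁻¹' T) := by
        rw [Measure.volume_eq_prod, Measure.prod_apply_symm hT]
    _ ≤ ∫⁻ y, (Metric.closedBall (0 : Fin m → ℂ) R).indicator
          (fun _ => ENNReal.ofReal ((δ / ‖q‖)^2) * (NNReal.pi : ENNReal)) y := by
        apply lintegral_mono
        intro y
        by_cases hy : y ∈ Metric.closedBall (0 : Fin m → ℂ) R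
        · rw [Set.indicator_of_mem hy]
          set c := (∑ j, y j * (q (i.succAbove j) : ℂ)) + (p : ℂ) with hc
          calc volume ((fun x => (x, y)) ⁻¹' T)
              ≤ volume (Metric.closedBall (-c / (q i : ℂ)) (δ / ‖q‖)) := by
                apply measure_mono
                rintro x ⟨-, hx⟩
                change ‖x * (q i : ℂ) + c‖ ≤ δ at hx
                rw [mem_closedBall_iff_norm, le_div_iff₀ hpos, ← hqn, ← norm_mul]
                have e : (x - -c / (q i : ℂ)) * (q i : ℂ) = x * (q i : ℂ) + c := by
                  rw [sub_mul, div_mul_cancel₀ _ hqi]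
                  ring
                rw [e]
                exact hx
            _ = _ := by
                rw [Complex.volume_closedBall, ENNReal.ofReal_pow (by positivity)]
        · rw [Set.indicator_of_notMem hy]
          have : (fun x => (x, y)) ⁻¹' T = ∅ := by
            ext x
            simp only [Set.mem_preimage, Set.mem_empty_iff_false, iff_false]
            rintro ⟨h, -⟩
            exact hy (by simpa using h)
          simp [this]
    _ = _ := by
        rw [lintegral_indicator_const Metric.isClosed_closedBall.measurableSet, mul_assoc]

lemma aux_sum (m : ℕ) (R : ℕ) (v : ℝ) (hv : (m : ℝ) < 2 * v) :
    ∑' pq : (Fin (m+1) → ℤ) × ℤ, volume {z : Fin (m+1) → ℂ | pq.1 ≠ 0 ∧ ‖z‖ ≤ R ∧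
      ‖(∑ i, z i * (pq.1 i : ℂ)) + (pq.2 : ℂ)‖ ≤ ‖pq.1‖ ^ (-v)} ≠ ⊤ := by
  have hv0 : 0 < v := by have : (0:ℝ) ≤ m := by positivity
                         linarith
  rw [ENNReal.tsum_prod (f := fun (q : Fin (m+1) → ℤ) (p : ℤ) => volume {z : Fin (m+1) → ℂ |
    q ≠ 0 ∧ ‖z‖ ≤ R ∧ ‖(∑ i, z i * (q i : ℂ)) + (p : ℂ)‖ ≤ ‖q‖ ^ (-v)})]
  set V : ENNReal := (NNReal.pi : ENNReal) * volume (Metric.closedBall (0 : Fin m → ℂ) R) with hV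
  have hVtop : V ≠ ⊤ := ENNReal.mul_ne_top (by simp) (measure_closedBall_lt_top).ne
  let K : ℕ := (m+1) * R + 1
  have key : ∀ q : Fin (m+1) → ℤ, ∑' p : ℤ, volume {z : Fin (m+1) → ℂ | q ≠ 0 ∧ ‖z‖ ≤ R ∧
      ‖(∑ i, z i * (q i : ℂ)) + (p : ℂ)‖ ≤ ‖q‖ ^ (-v)} ≤
      ENNReal.ofReal (‖q‖ ^ (-(2 * v + 1))) * (((2 * K + 1 : ℕ) : ENNReal) * V) := by
    intro q
    by_cases hq : q = 0
    · simp [hq]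
    have h1 := aux_norm_ge_one hq
    have hpos : 0 < ‖q‖ := by linarith
    obtain ⟨Q, hQ⟩ : ∃ Q : ℕ, ‖q‖ = Q := by
      obtain ⟨i, -, hi⟩ := Finset.exists_mem_eq_sup' (Finset.univ_nonempty) (fun i => ‖q i‖₊)
      refine ⟨(q i).natAbs, ?_⟩
      rw [Pi.norm_def, ← Finset.sup'_eq_sup Finset.univ_nonempty, hi]
      simp [Int.norm_eq_abs, Nat.cast_natAbs]
    have hQ1 : 1 ≤ Q := by rw [hQ] at h1; exact_mod_cast h1
    have hδ1 : ‖q‖ ^ (-v) ≤ 1 := Real.rpow_le_one_of_one_le_of_nonpos h1 (by linarith)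
    rw [tsum_eq_sum (s := Finset.Icc (-(K * Q : ℤ)) (K * Q))]
    · calc _ ≤ ∑ p ∈ Finset.Icc (-(K * Q : ℤ)) (K * Q),
            ENNReal.ofReal ((‖q‖ ^ (-v) / ‖q‖)^2) * V := by
            apply Finset.sum_le_sum
            intro p _
            refine le_trans (measure_mono ?_) (aux_measure m R q hq p (‖q‖ ^ (-v)) (by positivity))
            rintro z ⟨_, h⟩
            exact h
        _ = ((2 * (K * Q) + 1 : ℕ) : ENNReal) * (ENNReal.ofReal ((‖q‖ ^ (-v) / ‖q‖)^2) * V) := by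
            rw [Finset.sum_const, nsmul_eq_mul, Int.card_Icc]
            congr 2
            have : ((K:ℤ) * Q + 1 - -(K * Q : ℤ)) = ((2 * (K * Q) + 1 : ℕ) : ℤ) := by
              push_cast; ring
            rw [this, Int.toNat_natCast]
        _ ≤ (((2 * K + 1) * Q : ℕ) : ENNReal) * (ENNReal.ofReal ((‖q‖ ^ (-v) / ‖q‖)^2) * V) := by
            gcongr
            nlinarith
        _ = (ENNReal.ofReal ((‖q‖ ^ (-v) / ‖q‖)^2) * (Q : ENNReal)) *
              (((2 * K + 1 : ℕ) : ENNReal) * V) := by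
            push_cast; ring
        _ = _ := by
            congr 1
            rw [← ENNReal.ofReal_natCast, ← hQ, ← ENNReal.ofReal_mul (by positivity)]
            congr 1
            have e : -(2 * v + 1) = (-v) + (-v) + (-1) := by ring
            rw [e, Real.rpow_add hpos, Real.rpow_add hpos, Real.rpow_neg_one]
            field_simp
    · intro p hp
      convert measure_empty (μ := volume)
      ext z
      simp only [Set.mem_ofPred_eq, Set.mem_empty_iff_false, iff_false]
      rintro ⟨-, hz, hz2⟩
      apply hp
      rw [Finset.mem_Icc, ← abs_le]
      have hsum : ‖∑ i, z i * (q i : ℂ)‖ ≤ (m+1) * (R * Q) := by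
        calc _ ≤ ∑ i, ‖z i * (q i : ℂ)‖ := norm_sum_le _ _
          _ ≤ ∑ i : Fin (m+1), (R * Q : ℝ) := by
            apply Finset.sum_le_sum
            intro i _
            rw [norm_mul]
            gcongr
            · exact (norm_le_pi_norm z i).trans hz
            · rw [← hQ]
              refine le_trans (le_of_eq ?_) (norm_le_pi_norm q i)
              simp [Int.norm_eq_abs]
          _ = _ := by simp
      have hp' : ‖(p : ℂ)‖ ≤ K * Q := by
        calc ‖(p : ℂ)‖ = ‖((∑ i, z i * (q i : ℂ)) + (p : ℂ)) - ∑ i, z i * (q i : ℂ)‖ := by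
              congr 1; ring
          _ ≤ _ := norm_sub_le _ _
          _ ≤ 1 + (m+1) * (R * Q) := by linarith
          _ ≤ K * Q := by
              have : (1:ℝ) ≤ Q := by exact_mod_cast hQ1
              simp only [K]; push_cast; nlinarith
      rw [Complex.norm_intCast] at hp'
      exact_mod_cast hp'
  refine ne_top_of_le_ne_top ?_ (ENNReal.tsum_le_tsum key)
  rw [ENNReal.tsum_mul_right]
  refine ENNReal.mul_ne_top ?_ (ENNReal.mul_ne_top (ENNReal.natCast_ne_top _) hVtop)
  have := aux_summable (m+1) (2 * v + 1) (by push_cast; linarith)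
  exact this.tsum_ofReal_ne_top

lemma aux_upper (m : ℕ) : ∀ᵐ z ∂(volume : Measure (Fin (m+1) → ℂ)), ∀ v : ℝ, (m : ℝ) < 2 * v →
    {pq : (Fin (m+1) → ℤ) × ℤ |
      ‖(∑ i, z i * (pq.1 i : ℂ)) + (pq.2 : ℂ)‖ ≤ ‖pq.1‖ ^ (-v)}.Finite := by
  have h : ∀ R k : ℕ, ∀ᵐ z ∂(volume : Measure (Fin (m+1) → ℂ)),
      {pq : (Fin (m+1) → ℤ) × ℤ | z ∈ {z : Fin (m+1) → ℂ | pq.1 ≠ 0 ∧ ‖z‖ ≤ R ∧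
      ‖(∑ i, z i * (pq.1 i : ℂ)) + (pq.2 : ℂ)‖ ≤ ‖pq.1‖ ^ (-((m : ℝ) / 2 + 1 / ((k:ℝ)+1)))}}.Finite :=
    fun R k => ae_finite_setOfPred_mem (aux_sum m R _ (by
      have : (0:ℝ) < 1 / ((k:ℝ)+1) := by positivity
      linarith))
  have h' := ae_all_iff.2 fun R => ae_all_iff.2 (h R)
  filter_upwards [h'] with z hz v hv
  obtain ⟨R, hR⟩ := exists_nat_ge ‖z‖
  obtain ⟨k, hk⟩ := exists_nat_one_div_lt (show 0 < v - (m:ℝ)/2 by linarith)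
  have hv0 : 0 < v := by have : (0:ℝ) ≤ m := by positivity
                         linarith
  refine ((hz R k).union (Set.finite_singleton (0 : (Fin (m+1) → ℤ) × ℤ))).subset ?_
  rintro ⟨q, p⟩ hqp
  simp only [Set.mem_ofPred_eq] at hqp
  by_cases hq : q = 0
  · right
    subst hq
    simp [Real.zero_rpow (show -v ≠ 0 by linarith)] at hqp
    simp [hqp]
  · left
    refine ⟨hq, hR, hqp.trans ?_⟩
    exact Real.rpow_le_rpow_of_exponent_le (aux_norm_ge_one hq) (by linarith)

lemma aux_pigeon (m : ℕ) (z : Fin (m+1) → ℂ) (A N M : ℕ) (hA : ∑ i, ‖z i‖ ≤ A) (hN : 1 ≤ N)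
    (hM : 1 ≤ M) (h : (2 * A + 1) * M ^ 2 ≤ N ^ m) :
    ∃ (q : Fin (m+1) → ℤ) (p : ℤ), q ≠ 0 ∧ ‖q‖ ≤ N ∧
      ‖(∑ i, z i * (q i : ℂ)) + (p : ℂ)‖ ≤ 2 / M := by
  have hM0 : (0:ℝ) < M := by exact_mod_cast hM
  let F : (Fin (m+1) → Fin (N+1)) → ℂ := fun q => ∑ i, z i * ((q i : ℕ) : ℂ)
  have hF : ∀ q, ‖F q‖ ≤ A * N := by
    intro q
    calc ‖F q‖ ≤ ∑ i, ‖z i * ((q i : ℕ) : ℂ)‖ := norm_sum_le _ _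
      _ ≤ ∑ i, ‖z i‖ * N := by
        apply Finset.sum_le_sum
        intro i _
        rw [norm_mul, Complex.norm_natCast]
        gcongr
        exact_mod_cast Nat.lt_succ_iff.1 (q i).2
      _ = (∑ i, ‖z i‖) * N := by rw [Finset.sum_mul]
      _ ≤ _ := by gcongr
  let f : (Fin (m+1) → Fin (N+1)) → ℤ × ℤ := fun q =>
    (⌊M * (F q).im⌋, ⌊M * Int.fract (F q).re⌋)
  let t : Finset (ℤ × ℤ) := Finset.Icc (-(A * N * M : ℕ) : ℤ) (A * N * M : ℕ) ×ˢ Finset.Ico (0:ℤ) M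
  have ht : t.card < (Finset.univ : Finset (Fin (m+1) → Fin (N+1))).card := by
    have e1 : t.card = (2 * (A * N * M) + 1) * M := by
      simp only [t, Finset.card_product, Int.card_Icc, Int.card_Ico]
      congr 1
      · omega
    have e2 : (Finset.univ : Finset (Fin (m+1) → Fin (N+1))).card = (N+1)^(m+1) := by
      simp
    rw [e1, e2]
    calc (2 * (A * N * M) + 1) * M ≤ ((2 * A + 1) * M ^ 2) * N := by
          have : 1 ≤ N * M := Nat.mul_pos hN hM
          nlinarith
      _ ≤ N ^ m * N := by gcongr
      _ = N ^ (m+1) := by ring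
      _ < (N+1)^(m+1) := Nat.pow_lt_pow_left (by omega) (by omega)
  have hmaps : Set.MapsTo f (Finset.univ : Finset (Fin (m+1) → Fin (N+1))) t := by
    intro q _
    simp only [t, f, Finset.coe_product, Set.mem_prod, Finset.mem_coe, Finset.mem_Icc, Finset.mem_Ico]
    have h1 := abs_le.1 ((Complex.abs_im_le_norm (F q)).trans (hF q))
    refine ⟨⟨?_, ?_⟩, ?_, ?_⟩
    · rw [Int.le_floor]; push_cast; nlinarith
    · have : (⌊(M:ℝ) * (F q).im⌋ : ℝ) ≤ ((A * N * M : ℕ) : ℤ) := by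
        refine (Int.floor_le _).trans ?_
        push_cast; nlinarith
      exact_mod_cast this
    · have := Int.fract_nonneg (F q).re
      positivity
    · rw [Int.floor_lt]
      have := Int.fract_lt_one (F q).re
      push_cast; nlinarith
  obtain ⟨x, -, y, -, hxy, hf⟩ := Finset.exists_ne_map_eq_of_card_lt_of_maps_to ht hmaps
  simp only [f, Prod.mk.injEq] at hf
  have hi := Int.abs_sub_lt_one_of_floor_eq_floor hf.1
  have hr := Int.abs_sub_lt_one_of_floor_eq_floor hf.2
  rw [← mul_sub, abs_mul, abs_of_pos hM0] at hi hr
  refine ⟨fun i => ((x i : ℕ) : ℤ) - ((y i : ℕ) : ℤ), ⌊(F y).re⌋ - ⌊(F x).re⌋, ?_, ?_, ?_⟩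
  · intro h0
    apply hxy
    ext i
    have := congrFun h0 i
    simp only [Pi.zero_apply] at this
    omega
  · refine (pi_norm_le_iff_of_nonneg (by positivity)).2 fun i => ?_
    rw [Int.norm_eq_abs]
    have : |((x i : ℕ) : ℤ) - ((y i : ℕ) : ℤ)| ≤ N := by
      have := (x i).2
      have := (y i).2
      rw [abs_le]; omega
    exact_mod_cast this
  · have e : (∑ i, z i * (((((x i : ℕ) : ℤ) - ((y i : ℕ) : ℤ) : ℤ)) : ℂ)) = F x - F y := by
      simp only [F]
      rw [← Finset.sum_sub_distrib]
      refine Finset.sum_congr rfl fun i _ => ?_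
      push_cast; ring
    rw [e]
    refine (Complex.norm_le_abs_re_add_abs_im _).trans ?_
    have e1 : (F x - F y + ((⌊(F y).re⌋ - ⌊(F x).re⌋ : ℤ) : ℂ)).re =
        Int.fract (F x).re - Int.fract (F y).re := by
      rw [Complex.add_re, Complex.sub_re, Complex.intCast_re]
      simp only [Int.fract]
      push_cast; ring
    have e2 : (F x - F y + ((⌊(F y).re⌋ - ⌊(F x).re⌋ : ℤ) : ℂ)).im = (F x).im - (F y).im := by
      rw [Complex.add_im, Complex.sub_im, Complex.intCast_im]; ring
    rw [e1, e2, le_div_iff₀ hM0]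
    linarith

lemma aux_lower (m : ℕ) (z : Fin (m+1) → ℂ) (v : ℝ) (hv0 : 0 < v) (hv : 2 * v < m) :
    {pq : (Fin (m+1) → ℤ) × ℤ |
      ‖(∑ i, z i * (pq.1 i : ℂ)) + (pq.2 : ℂ)‖ ≤ ‖pq.1‖ ^ (-v)}.Infinite := by
  intro hfin
  obtain ⟨A, hA⟩ := exists_nat_ge (∑ i, ‖z i‖)
  -- no exact zeros
  have hne : ∀ pq : (Fin (m+1) → ℤ) × ℤ, pq.1 ≠ 0 →
      0 < ‖(∑ i, z i * (pq.1 i : ℂ)) + (pq.2 : ℂ)‖ := by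
    rintro ⟨q, p⟩ hq
    by_contra hcon
    have h0 : (∑ i, z i * (q i : ℂ)) + (p : ℂ) = 0 := by
      simpa using hcon
    refine Set.infinite_of_injective_forall_mem (f := fun k : ℕ => (k • q, k • p)) ?_ ?_ hfin
    · intro a b hab
      obtain ⟨i, hi⟩ := Function.ne_iff.1 hq
      have := congrFun (congrArg Prod.fst hab) i
      simp only [Pi.smul_apply, nsmul_eq_mul] at this
      exact_mod_cast mul_right_cancel₀ hi this
    · intro k
      have : (∑ i, z i * (((k • q) i : ℤ) : ℂ)) + ((k • p : ℤ) : ℂ) =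
          k * ((∑ i, z i * (q i : ℂ)) + (p : ℂ)) := by
        rw [mul_add, Finset.mul_sum]
        congr 1
        · refine Finset.sum_congr rfl fun i _ => ?_
          simp; ring
        · simp
      simp only [Set.mem_ofPred_eq]
      rw [this, h0, mul_zero, norm_zero]
      positivity
  have hev : ∀ᶠ N : ℕ in Filter.atTop, ∀ pq ∈ {pq : (Fin (m+1) → ℤ) × ℤ |
      ‖(∑ i, z i * (pq.1 i : ℂ)) + (pq.2 : ℂ)‖ ≤ ‖pq.1‖ ^ (-v)}, pq.1 ≠ 0 →
      (N : ℝ) ^ (-v) < ‖(∑ i, z i * (pq.1 i : ℂ)) + (pq.2 : ℂ)‖ := by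
    rw [Filter.eventually_all_finite hfin]
    intro pq _
    by_cases hq : pq.1 = 0
    · simp [hq]
    have := (tendsto_rpow_neg_atTop hv0).comp (tendsto_natCast_atTop_atTop (R := ℝ))
    filter_upwards [this.eventually (gt_mem_nhds (hne pq hq))] with N hN _
    exact hN
  have hev2 : ∀ᶠ N : ℕ in Filter.atTop, (9 * (2 * A + 1) : ℝ) ≤ (N : ℝ) ^ ((m : ℝ) - 2 * v) :=
    ((tendsto_rpow_atTop (sub_pos.2 hv)).comp
      (tendsto_natCast_atTop_atTop (R := ℝ))).eventually_ge_atTop _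
  obtain ⟨N, h1, h2, hN⟩ := (hev.and (hev2.and (Filter.eventually_ge_atTop 1))).exists
  have hN1 : (1:ℝ) ≤ N := by exact_mod_cast hN
  have hN0 : (0:ℝ) < N := by linarith
  set M := ⌈2 * (N:ℝ) ^ v⌉₊ with hMdef
  have hNv : 1 ≤ (N:ℝ) ^ v := Real.one_le_rpow hN1 hv0.le
  have hMge : 2 * (N:ℝ) ^ v ≤ M := Nat.le_ceil _
  have hMle : (M:ℝ) ≤ 3 * (N:ℝ) ^ v := by
    have := Nat.ceil_lt_add_one (show 0 ≤ 2 * (N:ℝ) ^ v by positivity)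
    linarith
  have hM0 : (0:ℝ) < M := by linarith
  have hM1 : 1 ≤ M := by exact_mod_cast hM0
  have hcond : (2 * A + 1) * M ^ 2 ≤ N ^ m := by
    have : ((2 * A + 1) * M ^ 2 : ℝ) ≤ (N:ℝ) ^ m := by
      calc ((2 * A + 1) * M ^ 2 : ℝ) ≤ (2 * A + 1) * (3 * (N:ℝ) ^ v) ^ 2 := by gcongr
        _ = (9 * (2 * A + 1)) * ((N:ℝ) ^ v * (N:ℝ) ^ v) := by ring
        _ ≤ (N : ℝ) ^ ((m : ℝ) - 2 * v) * ((N:ℝ) ^ v * (N:ℝ) ^ v) := by gcongr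
        _ = (N:ℝ) ^ m := by
          rw [← Real.rpow_add hN0, ← Real.rpow_add hN0, ← Real.rpow_natCast]
          congr 1; ring
    exact_mod_cast this
  obtain ⟨q, p, hq, hqN, hval⟩ := aux_pigeon m z A N M hA hN hM1 hcond
  have hval2 : ‖(∑ i, z i * (q i : ℂ)) + (p : ℂ)‖ ≤ (N:ℝ) ^ (-v) := by
    refine hval.trans ?_
    rw [Real.rpow_neg hN0.le, div_le_iff₀ hM0, inv_mul_eq_div, le_div_iff₀ (by positivity)]
    exact hMge
  have hq1 := aux_norm_ge_one hq
  have := h1 (q, p) (hval2.trans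
    (Real.rpow_le_rpow_of_nonpos (by linarith) hqN (by linarith))) hq
  exact absurd hval2 (not_le.2 this)

theorem omegaStd_ae_eq (n : ℕ) (hn : 1 ≤ n) :
    ∀ᵐ z ∂(volume : Measure (Fin n → ℂ)),
      omegaStd n z = ENNReal.ofReal (((n : ℝ) - 1) / 2) := by
  obtain ⟨m, rfl⟩ : ∃ m, n = m + 1 := ⟨n - 1, by omega⟩
  have e : (((m + 1 : ℕ) : ℝ) - 1) / 2 = m / 2 := by push_cast; ring
  rw [e]
  filter_upwards [aux_upper m] with z hz
  unfold omegaStd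
  apply le_antisymm
  · apply sSup_le
    rintro _ ⟨v, ⟨_, hinf⟩, rfl⟩
    apply ENNReal.ofReal_le_ofReal
    by_contra hcon
    exact hinf (hz v (by linarith))
  · apply le_of_forall_lt
    intro c hc
    have hctop : c ≠ ⊤ := ne_top_of_lt hc
    rw [ENNReal.lt_ofReal_iff_toReal_lt hctop] at hc
    have hc0 : 0 ≤ c.toReal := ENNReal.toReal_nonneg
    obtain ⟨v, hv1, hv2⟩ := exists_between hc
    refine lt_of_lt_of_le ((ENNReal.lt_ofReal_iff_toReal_lt hctop).2 hv1) (le_sSup ⟨v, ⟨?_, ?_⟩, rfl⟩)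
    · linarith
    · exact aux_lower m z v (by linarith) (by linarith)
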